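/- arXiv:2011.11884 — 2 statements merged into one kernel-verified Lean document; each statement's English description precedes it below -/
import Mathlib

section
/- For the SMG iterates with arbitrary permutations, under L-smoothness (b), generalized bounded variance (c), and assuming L²·ξ_s² ≤ 2/5 for every s ∈ {1,…,t}, the following holds for every t ≥ 2: β·J_t + (1−β)·I_t ≤ (9·(5−3β)·L²·ξ_t²/2) · ( n·(Θ+1)·Σ_{j=1}^{t} β^{t−j}·‖∇F(w_0^(j))‖² + n·σ²/(1−β) ). -/
open Finset

theorem sum_range_cast_le (n : ℕ) : ∑ i ∈ range n, (i : ℝ) ≤ (n : ℝ) ^ 2 / 2 := by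
  induction n with
  | zero => simp
  | succ k ih => rw [sum_range_succ]; push_cast; nlinarith

section Epoch

variable {E : Type*} [NormedAddCommGroup E]
  {n : ℕ} {β η L : ℝ} {w g : ℕ → E} {m₀ : E}

/-- Cauchy–Schwarz for a finite sum of vectors. -/
theorem norm_sum_sq_le_card_mul_sum_sq {ι : Type*} (s : Finset ι) (x : ι → E) :
    ‖∑ i ∈ s, x i‖ ^ 2 ≤ (s.card : ℝ) * ∑ i ∈ s, ‖x i‖ ^ 2 :=
  (pow_le_pow_left₀ (norm_nonneg _) (norm_sum_le s x) 2).trans sq_sum_le_card_mul_sum_sq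

/-- Deviation of the component gradients used in one epoch from those at a reference iterate. -/
theorem sum_norm_sub_sq_le_of_dist_le {G : Fin n → E → E}
    (hG : ∀ i x y, ‖G i x - G i y‖ ≤ L * ‖x - y‖)
    (hg : ∀ i : Fin n, g i = G i (w i)) {z : E} {c : ℕ → ℝ}
    (hc : ∀ i < n, ‖z - w i‖ ^ 2 ≤ c i) :
    ∑ i : Fin n, ‖G i z - g i‖ ^ 2 ≤ L ^ 2 * ∑ i ∈ range n, c i := by
  rw [← Fin.sum_univ_eq_sum_range, mul_sum]
  refine sum_le_sum fun i _ => ?_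
  rw [hg i]
  calc ‖G i z - G i (w i)‖ ^ 2 ≤ (L * ‖z - w i‖) ^ 2 :=
        pow_le_pow_left₀ (norm_nonneg _) (hG i _ _) 2
    _ = L ^ 2 * ‖z - w i‖ ^ 2 := mul_pow _ _ _
    _ ≤ L ^ 2 * c i := mul_le_mul_of_nonneg_left (hc i i.2) (sq_nonneg L)

/-- The gradients used in one epoch in terms of those at its start. -/
theorem sum_norm_sq_le_two_mul_add {G : Fin n → E → E} (z : E) :
    ∑ i ∈ range n, ‖g i‖ ^ 2 ≤
      2 * ∑ i, ‖G i z‖ ^ 2 + 2 * ∑ i : Fin n, ‖G i z - g i‖ ^ 2 := by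
  rw [← Fin.sum_univ_eq_sum_range (fun i => ‖g i‖ ^ 2), mul_sum, mul_sum, ← sum_add_distrib]
  refine sum_le_sum fun i _ => ?_
  have h : ‖g i‖ ≤ ‖G i z‖ + ‖G i z - g i‖ := by
    simpa using norm_sub_le (G i z) (G i z - g i)
  nlinarith [pow_le_pow_left₀ (norm_nonneg _) h 2, sq_nonneg (‖G i z‖ - ‖G i z - g i‖)]

variable [NormedSpace ℝ E]

/-- Convexity of the squared norm along a segment. -/
theorem norm_convex_combination_sq_le (hβ0 : 0 ≤ β) (hβ1 : β ≤ 1) (x y : E) :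
    ‖β • x + (1 - β) • y‖ ^ 2 ≤ β * ‖x‖ ^ 2 + (1 - β) * ‖y‖ ^ 2 := by
  have h : ‖β • x + (1 - β) • y‖ ≤ β * ‖x‖ + (1 - β) * ‖y‖ := by
    refine (norm_add_le _ _).trans_eq ?_
    rw [norm_smul, norm_smul, Real.norm_of_nonneg hβ0, Real.norm_of_nonneg (sub_nonneg.2 hβ1)]
  have h2 := pow_le_pow_left₀ (norm_nonneg _) h 2
  nlinarith [mul_nonneg (mul_nonneg hβ0 (sub_nonneg.2 hβ1)) (sq_nonneg (‖x‖ - ‖y‖))]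

/-- Displacement between two inner iterates of one epoch of momentum steps. -/
theorem norm_sub_sq_le_of_momentum_steps (hn : 1 ≤ n) (hβ0 : 0 ≤ β) (hβ1 : β ≤ 1)
    (hw : ∀ i < n, w (i + 1) = w i - (η / (n : ℝ)) • (β • m₀ + (1 - β) • g i))
    {a b : ℕ} (hab : a ≤ b) (hb : b ≤ n) :
    ‖w b - w a‖ ^ 2 ≤ η ^ 2 / (n : ℝ) ^ 2 * ((b : ℝ) - a) *
      (β * (n * ‖m₀‖ ^ 2) + (1 - β) * ∑ i ∈ range n, ‖g i‖ ^ 2) := by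
  have htel : w b - w a = -((η / (n : ℝ)) • ∑ i ∈ Ico a b, (β • m₀ + (1 - β) • g i)) := by
    rw [← sum_Ico_sub w hab, smul_sum, ← sum_neg_distrib]
    refine sum_congr rfl fun i hi => ?_
    rw [hw i ((mem_Ico.1 hi).2.trans_le hb)]
    abel
  have hsub : Ico a b ⊆ range n := fun i hi => mem_range.2 ((mem_Ico.1 hi).2.trans_le hb)
  have hterms : ∑ i ∈ Ico a b, ‖β • m₀ + (1 - β) • g i‖ ^ 2 ≤
      β * (n * ‖m₀‖ ^ 2) + (1 - β) * ∑ i ∈ range n, ‖g i‖ ^ 2 := by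
    calc ∑ i ∈ Ico a b, ‖β • m₀ + (1 - β) • g i‖ ^ 2
        ≤ ∑ i ∈ range n, ‖β • m₀ + (1 - β) • g i‖ ^ 2 :=
          sum_le_sum_of_subset_of_nonneg hsub fun _ _ _ => sq_nonneg _
      _ ≤ ∑ i ∈ range n, (β * ‖m₀‖ ^ 2 + (1 - β) * ‖g i‖ ^ 2) :=
          sum_le_sum fun i _ => norm_convex_combination_sq_le hβ0 hβ1 _ _
      _ = _ := by
          rw [sum_add_distrib, sum_const, ← mul_sum, card_range, nsmul_eq_mul]
          ring
  have hcs := norm_sum_sq_le_card_mul_sum_sq (Ico a b) fun i => β • m₀ + (1 - β) • g i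
  rw [Nat.card_Ico, Nat.cast_sub hab] at hcs
  have hab' : (0 : ℝ) ≤ (b : ℝ) - a := sub_nonneg.2 (Nat.cast_le.2 hab)
  rw [htel, norm_neg, norm_smul, mul_pow, Real.norm_eq_abs, sq_abs, div_pow, mul_assoc]
  exact mul_le_mul_of_nonneg_left (hcs.trans (mul_le_mul_of_nonneg_left hterms hab'))
    (by positivity)

theorem sum_norm_start_sub_sq_le (hn : 1 ≤ n) (hβ0 : 0 ≤ β) (hβ1 : β ≤ 1)
    (hw : ∀ i < n, w (i + 1) = w i - (η / (n : ℝ)) • (β • m₀ + (1 - β) • g i))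
    {G : Fin n → E → E} (hG : ∀ i x y, ‖G i x - G i y‖ ≤ L * ‖x - y‖)
    (hg : ∀ i : Fin n, g i = G i (w i)) :
    ∑ i : Fin n, ‖G i (w 0) - g i‖ ^ 2 ≤ L ^ 2 * η ^ 2 *
      (β * (n * ‖m₀‖ ^ 2) + (1 - β) * ∑ i ∈ range n, ‖g i‖ ^ 2) / 2 := by
  set P := β * (n * ‖m₀‖ ^ 2) + (1 - β) * ∑ i ∈ range n, ‖g i‖ ^ 2 with hP
  have hP0 : 0 ≤ P := by have := sub_nonneg.2 hβ1; positivity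
  have hn0 : (n : ℝ) ≠ 0 := by positivity
  have h := sum_norm_sub_sq_le_of_dist_le (z := w 0)
    (c := fun i => η ^ 2 / (n : ℝ) ^ 2 * P * i) hG hg fun i hi => by
      have := norm_sub_sq_le_of_momentum_steps hn hβ0 hβ1 hw (Nat.zero_le i) hi.le
      rw [norm_sub_rev]
      refine this.trans_eq ?_
      simp only [Nat.cast_zero, sub_zero, ← hP]
      ring
  refine h.trans ?_
  rw [← mul_sum]
  calc L ^ 2 * (η ^ 2 / (n : ℝ) ^ 2 * P * ∑ i ∈ range n, (i : ℝ))
      ≤ L ^ 2 * (η ^ 2 / (n : ℝ) ^ 2 * P * ((n : ℝ) ^ 2 / 2)) := by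
        gcongr
        exact sum_range_cast_le n
    _ = L ^ 2 * η ^ 2 * P / 2 := by field_simp

theorem sum_norm_finish_sub_sq_le (hn : 1 ≤ n) (hβ0 : 0 ≤ β) (hβ1 : β ≤ 1)
    (hw : ∀ i < n, w (i + 1) = w i - (η / (n : ℝ)) • (β • m₀ + (1 - β) • g i))
    {G : Fin n → E → E} (hG : ∀ i x y, ‖G i x - G i y‖ ≤ L * ‖x - y‖)
    (hg : ∀ i : Fin n, g i = G i (w i)) :
    ∑ i : Fin n, ‖G i (w n) - g i‖ ^ 2 ≤ L ^ 2 * η ^ 2 *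
      (β * (n * ‖m₀‖ ^ 2) + (1 - β) * ∑ i ∈ range n, ‖g i‖ ^ 2) := by
  set P := β * (n * ‖m₀‖ ^ 2) + (1 - β) * ∑ i ∈ range n, ‖g i‖ ^ 2 with hP
  have hP0 : 0 ≤ P := by have := sub_nonneg.2 hβ1; positivity
  have hn0 : (n : ℝ) ≠ 0 := by positivity
  have h := sum_norm_sub_sq_le_of_dist_le (z := w n)
    (c := fun _ => η ^ 2 / (n : ℝ) ^ 2 * n * P) hG hg fun i hi => by
      refine (norm_sub_sq_le_of_momentum_steps hn hβ0 hβ1 hw hi.le le_rfl).trans ?_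
      have hi0 : (0 : ℝ) ≤ i := Nat.cast_nonneg i
      rw [← hP]
      gcongr
      linarith
  refine h.trans_eq ?_
  rw [sum_const, card_range, nsmul_eq_mul]
  field_simp

end Epoch

/-- The sum of squared deviations from the mean, expanded. -/
theorem sum_norm_sub_mean_sq {E : Type*} [NormedAddCommGroup E] [InnerProductSpace ℝ E]
    {n : ℕ} (hn : 1 ≤ n) (x : Fin n → E) (μ : E)
    (hμ : μ = (1 / (n : ℝ)) • ∑ i, x i) :
    ∑ i, ‖x i - μ‖ ^ 2 = ∑ i, ‖x i‖ ^ 2 - n * ‖μ‖ ^ 2 := by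
  have hn0 : (n : ℝ) ≠ 0 := by positivity
  have hsum : ∑ i, x i = (n : ℝ) • μ := by
    rw [hμ, smul_smul, mul_one_div_cancel hn0, one_smul]
  simp only [norm_sub_sq_real, sum_add_distrib, sum_sub_distrib, ← mul_sum, ← sum_inner, hsum,
    real_inner_smul_left, real_inner_self_eq_norm_sq, sum_const, card_univ, Fintype.card_fin,
    nsmul_eq_mul]
  ring

/-- The gradient of an average is the average of the gradients. -/
theorem gradient_average {H : Type*} [NormedAddCommGroup H] [InnerProductSpace ℝ H]
    [CompleteSpace H] {n : ℕ} (f : Fin n → H → ℝ) (hf : ∀ i, Differentiable ℝ (f i)) (x : H) :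
    gradient (fun y => (1 / (n : ℝ)) * ∑ i, f i y) x =
      (1 / (n : ℝ)) • ∑ i, gradient (f i) x := by
  have h : HasFDerivAt (fun y => (1 / (n : ℝ)) * ∑ i, f i y)
      ((1 / (n : ℝ)) • ∑ i, fderiv ℝ (f i) x) x :=
    (HasFDerivAt.fun_sum fun i _ => (hf i x).hasFDerivAt).const_mul _
  simp only [gradient, h.fderiv, map_smulₛₗ, map_sum, conj_trivial]

/-- The geometrically weighted sum of `K 1, …, K t`. -/
def geomWeightedSum (β : ℝ) (K : ℕ → ℝ) (t : ℕ) : ℝ := ∑ j ∈ Icc 1 t, β ^ (t - j) * K j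

theorem geomWeightedSum_succ (β : ℝ) (K : ℕ → ℝ) (t : ℕ) :
    geomWeightedSum β K (t + 1) = β * geomWeightedSum β K t + K (t + 1) := by
  unfold geomWeightedSum
  rw [sum_Icc_succ_top (by omega), mul_sum, Nat.sub_self, pow_zero, one_mul]
  congr 1
  refine sum_congr rfl fun j hj => ?_
  rw [Nat.succ_sub (mem_Icc.1 hj).2, pow_succ]
  ring

theorem geomWeightedSum_nonneg {β : ℝ} (hβ : 0 ≤ β) {K : ℕ → ℝ} (hK : ∀ t, 0 ≤ K t) (t : ℕ) :
    0 ≤ geomWeightedSum β K t :=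
  sum_nonneg fun j _ => mul_nonneg (pow_nonneg hβ _) (hK j)

theorem geomWeightedSum_one_le {β : ℝ} (hβ0 : 0 ≤ β) (hβ1 : β < 1) (t : ℕ) :
    geomWeightedSum β (fun _ => 1) t ≤ 1 / (1 - β) := by
  have h1 : 0 < 1 - β := sub_pos.2 hβ1
  induction t with
  | zero => simpa [geomWeightedSum] using h1.le
  | succ k ih =>
    rw [geomWeightedSum_succ]
    calc β * geomWeightedSum β (fun _ => 1) k + 1 ≤ β * (1 / (1 - β)) + 1 := by gcongr
      _ = 1 / (1 - β) := by field_simp; ring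

/-- A linear recursion with contraction factor `β` is dominated by its weighted forcing terms. -/
theorem le_geomWeightedSum_of_recursion {β : ℝ} (hβ0 : 0 ≤ β) {A K : ℕ → ℝ} {c : ℝ} {N : ℕ}
    (hA0 : A 0 = 0) (hA : ∀ t < N, A (t + 1) ≤ c * K (t + 1) + β * A t) :
    ∀ t ≤ N, A t ≤ c * geomWeightedSum β K t := by
  intro t ht
  induction t with
  | zero => simp [geomWeightedSum, hA0]
  | succ k ih =>
    rw [geomWeightedSum_succ]
    have := mul_le_mul_of_nonneg_left (ih (by omega)) hβ0
    have := hA k (by omega)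
    linarith

theorem smg_lemma4
    (n d : ℕ) (hn : 1 ≤ n) (hd : 1 ≤ d)
    (f : Fin n → EuclideanSpace ℝ (Fin d) → ℝ)
    (hf : ∀ i, Differentiable ℝ (f i))
    (F : EuclideanSpace ℝ (Fin d) → ℝ)
    (hF : F = fun x => (1 / (n : ℝ)) * ∑ i, f i x)
    (L : ℝ) (hL : 0 < L)
    (hsmooth : ∀ i x y, ‖gradient (f i) x - gradient (f i) y‖ ≤ L * ‖x - y‖)
    (Θ σ : ℝ) (hΘ : 0 ≤ Θ) (hσ : 0 ≤ σ)
    (hvar : ∀ x, (1 / (n : ℝ)) * ∑ i, ‖gradient (f i) x - gradient F x‖ ^ 2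
        ≤ Θ * ‖gradient F x‖ ^ 2 + σ ^ 2)
    (T : ℕ) (hT : 1 ≤ T)
    (β : ℝ) (hβ0 : 0 ≤ β) (hβ1 : β < 1)
    (η : ℕ → ℝ) (hηpos : ∀ t, 1 ≤ t → t ≤ T → 0 < η t)
    (π : ℕ → Equiv.Perm (Fin n))
    (w m v g : ℕ → ℕ → EuclideanSpace ℝ (Fin d))
    (wt mt : ℕ → EuclideanSpace ℝ (Fin d))
    (hmt0 : mt 0 = 0)
    (hw0 : ∀ t, 1 ≤ t → t ≤ T → w t 0 = wt (t - 1))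
    (hm0 : ∀ t, 1 ≤ t → t ≤ T → m t 0 = mt (t - 1))
    (hv0 : ∀ t, 1 ≤ t → t ≤ T → v t 0 = 0)
    (hg : ∀ t, 1 ≤ t → t ≤ T → ∀ i, ∀ hi : i < n,
        g t i = gradient (f (π t ⟨i, hi⟩)) (w t i))
    (hm1 : ∀ t, 1 ≤ t → t ≤ T → ∀ i, i < n →
        m t (i + 1) = β • m t 0 + (1 - β) • g t i)
    (hv1 : ∀ t, 1 ≤ t → t ≤ T → ∀ i, i < n →
        v t (i + 1) = v t i + ((n : ℝ))⁻¹ • g t i)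
    (hw1 : ∀ t, 1 ≤ t → t ≤ T → ∀ i, i < n →
        w t (i + 1) = w t i - (η t / (n : ℝ)) • m t (i + 1))
    (hwt : ∀ t, 1 ≤ t → t ≤ T → wt t = w t n)
    (hmt : ∀ t, 1 ≤ t → t ≤ T → mt t = v t n)
    (ξ : ℕ → ℝ) (hξ1 : ξ 1 = η 1) (hξ : ∀ t, 2 ≤ t → ξ t = max (η t) (η (t - 1)))
    (I K' : ℕ → ℝ)
    (hI : ∀ t, I t = ∑ i : Fin n, ‖gradient (f (π t i)) (w t 0) - g t (i : ℕ)‖ ^ 2)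
    (hK' : ∀ t, K' t = (n : ℝ) * (Θ + 1) * ‖gradient F (w t 0)‖ ^ 2 + (n : ℝ) * σ ^ 2)
    (J : ℕ → ℝ)
    (hJ : ∀ t, 2 ≤ t →
        J t = ∑ i : Fin n, ‖gradient (f (π (t - 1) i)) (w t 0) - g (t - 1) (i : ℕ)‖ ^ 2)
    :
    ∀ t, 2 ≤ t → t ≤ T →
      (∀ s, 1 ≤ s → s ≤ t → L ^ 2 * ξ s ^ 2 ≤ 2 / 5) →
      β * J t + (1 - β) * I t ≤
        9 * (5 - 3 * β) * L ^ 2 * ξ t ^ 2 / 2 *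
          ((n : ℝ) * (Θ + 1) * ∑ j ∈ Icc 1 t, β ^ (t - j) * ‖gradient F (w j 0)‖ ^ 2
            + (n : ℝ) * σ ^ 2 / (1 - β)) := by
  intro t ht2 htT hstep
  obtain ⟨k, rfl⟩ : ∃ k, t = k + 2 := ⟨t - 2, by omega⟩
  have hn0 : (0 : ℝ) < n := by exact_mod_cast hn
  have hx : 0 ≤ 1 - β := by linarith
  have hK0 : ∀ s, 0 ≤ K' s := fun s => by rw [hK']; positivity
  have hηξ : ∀ s, 1 ≤ s → η s ≤ ξ s := by
    intro s hs
    rcases hs.eq_or_lt with rfl | hs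
    · exact hξ1.ge
    · rw [hξ s hs]; exact le_max_left _ _
  set A : ℕ → ℝ := fun s => if s = 0 then 0 else ∑ i ∈ range n, ‖g s i‖ ^ 2 with hA
  have hAsucc : ∀ s, A (s + 1) = ∑ i ∈ range n, ‖g (s + 1) i‖ ^ 2 := fun s => by simp [hA]
  have hA0 : ∀ s, 0 ≤ A s := fun s => by simp only [hA]; split_ifs <;> positivity
  -- the momentum carried over from an epoch is the average of its gradients
  have hmom : ∀ s < T, (n : ℝ) * ‖m (s + 1) 0‖ ^ 2 ≤ A s := by
    intro s hs
    rw [hm0 (s + 1) (by omega) hs, Nat.add_sub_cancel]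
    rcases s with _ | s
    · simp [hmt0, hA]
    · have hv : ∀ i ≤ n, v (s + 1) i = (n : ℝ)⁻¹ • ∑ j ∈ range i, g (s + 1) j := by
        intro i hi
        induction i with
        | zero => simp [hv0 (s + 1) (by omega) hs.le]
        | succ i ih =>
          rw [hv1 (s + 1) (by omega) hs.le i hi, ih (by omega), sum_range_succ, smul_add]
      have hcs := norm_sum_sq_le_card_mul_sum_sq (range n) (g (s + 1))
      rw [card_range] at hcs
      rw [hmt (s + 1) (by omega) hs.le, hv n le_rfl, norm_smul, mul_pow, hAsucc, norm_inv,
        Real.norm_of_nonneg hn0.le]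
      calc (n : ℝ) * ((n : ℝ)⁻¹ ^ 2 * ‖∑ j ∈ range n, g (s + 1) j‖ ^ 2)
          ≤ n * ((n : ℝ)⁻¹ ^ 2 * (n * ∑ j ∈ range n, ‖g (s + 1) j‖ ^ 2)) := by gcongr
        _ = _ := by field_simp
  have hw : ∀ s < T, ∀ i < n, w (s + 1) (i + 1) = w (s + 1) i -
      (η (s + 1) / (n : ℝ)) • (β • m (s + 1) 0 + (1 - β) • g (s + 1) i) := fun s hs i hi => by
    rw [hw1 (s + 1) (by omega) hs i hi, hm1 (s + 1) (by omega) hs i hi]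
  set P : ℕ → ℝ := fun s => β * A s + (1 - β) * A (s + 1) with hP
  have hP0 : ∀ s, 0 ≤ P s := fun s =>
    add_nonneg (mul_nonneg hβ0 (hA0 _)) (mul_nonneg hx (hA0 _))
  have hPle : ∀ s < T, β * (n * ‖m (s + 1) 0‖ ^ 2) +
      (1 - β) * ∑ i ∈ range n, ‖g (s + 1) i‖ ^ 2 ≤ P s := fun s hs => by
    simp only [hP, ← hAsucc]
    gcongr
    exact hmom s hs
  have hIle : ∀ s < T, I (s + 1) ≤ L ^ 2 * η (s + 1) ^ 2 * P s / 2 := fun s hs => by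
    rw [hI]
    refine (sum_norm_start_sub_sq_le hn hβ0 hβ1.le (hw s hs)
      (G := fun i => gradient (f (π (s + 1) i))) (fun i => hsmooth _)
      fun i => hg (s + 1) (by omega) hs i i.2).trans ?_
    gcongr
    exact hPle s hs
  have hJle : J (k + 2) ≤ L ^ 2 * η (k + 1) ^ 2 * P k := by
    rw [hJ _ ht2, hw0 (k + 2) (by omega) htT, show k + 2 - 1 = k + 1 by omega,
      hwt (k + 1) (by omega) (by omega)]
    refine (sum_norm_finish_sub_sq_le hn hβ0 hβ1.le (hw k (by omega))
      (G := fun i => gradient (f (π (k + 1) i))) (fun i => hsmooth _)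
      fun i => hg (k + 1) (by omega) (by omega) i i.2).trans ?_
    gcongr
    exact hPle k (by omega)
  have hgrad : ∀ x, ∑ i, ‖gradient (f i) x‖ ^ 2 ≤
      (n : ℝ) * (Θ + 1) * ‖gradient F x‖ ^ 2 + n * σ ^ 2 := by
    intro x
    have hmean := sum_norm_sub_mean_sq hn (fun i => gradient (f i) x) (gradient F x)
      (by rw [hF]; exact gradient_average f hf x)
    have h := mul_le_mul_of_nonneg_left (hvar x) hn0.le
    rw [← mul_assoc, mul_one_div_cancel hn0.ne', one_mul, hmean] at h
    linarith
  have hArec : ∀ s < k + 2, A (s + 1) ≤ 10 / 3 * K' (s + 1) + β * A s := by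
    intro s hs
    have hbound := sum_norm_sq_le_two_mul_add (g := g (s + 1))
      (G := fun i => gradient (f (π (s + 1) i))) (w (s + 1) 0)
    have hperm := Equiv.sum_comp (π (s + 1)) fun i => ‖gradient (f i) (w (s + 1) 0)‖ ^ 2
    rw [hperm, ← hI, ← hAsucc] at hbound
    have hK := hgrad (w (s + 1) 0)
    rw [← hK'] at hK
    have hq : L ^ 2 * η (s + 1) ^ 2 ≤ 2 / 5 := by
      have hpos := (hηpos (s + 1) (by omega) (by omega)).le
      have := hηξ (s + 1) (by omega)
      exact le_trans (by gcongr) (hstep (s + 1) (by omega) (by omega))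
    have hI' := hIle s (by omega)
    have hqP := mul_le_mul_of_nonneg_right hq (hP0 s)
    have h : A (s + 1) ≤ 2 * K' (s + 1) + 2 / 5 * (β * A s + (1 - β) * A (s + 1)) := by
      change _ ≤ 2 / 5 * (β * A s + (1 - β) * A (s + 1)) at hqP
      linarith
    nlinarith [mul_nonneg hβ0 (hA0 s), mul_nonneg hβ0 (hA0 (s + 1))]
  have hAS := le_geomWeightedSum_of_recursion hβ0 (by simp [hA]) hArec
  set S := geomWeightedSum β K' with hS
  have hS0 : ∀ s, 0 ≤ S s := geomWeightedSum_nonneg hβ0 hK0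
  have hSmono : ∀ s, β * S s ≤ S (s + 1) := fun s => by
    rw [hS, geomWeightedSum_succ]
    linarith [hK0 (s + 1)]
  have hPS : ∀ s < k + 2, P s ≤ 10 / 3 * (2 - β) * S (s + 1) := fun s hs => by
    have h1 := mul_le_mul_of_nonneg_left (hAS s hs.le) hβ0
    have h2 := mul_le_mul_of_nonneg_left (hAS (s + 1) hs) hx
    have h3 := hSmono s
    simp only [hP]
    linarith
  have hSle : S (k + 2) ≤ (n : ℝ) * (Θ + 1) *
      ∑ j ∈ Icc 1 (k + 2), β ^ (k + 2 - j) * ‖gradient F (w j 0)‖ ^ 2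
        + (n : ℝ) * σ ^ 2 / (1 - β) := by
    have h := mul_le_mul_of_nonneg_left (geomWeightedSum_one_le hβ0 hβ1 (k + 2))
      (show 0 ≤ (n : ℝ) * σ ^ 2 by positivity)
    rw [mul_one_div] at h
    refine le_trans (le_of_eq ?_) (add_le_add_right h _)
    simp only [hS, geomWeightedSum, hK', mul_sum, ← sum_add_distrib]
    exact sum_congr rfl fun j _ => by ring
  have hη1 : η (k + 1) ≤ ξ (k + 2) := by
    rw [hξ _ ht2]
    exact le_max_right _ _
  have hpos1 := (hηpos (k + 1) (by omega) (by omega)).le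
  have hpos2 := (hηpos (k + 2) (by omega) htT).le
  have hη2 := hηξ (k + 2) (by omega)
  have hJfin : J (k + 2) ≤ L ^ 2 * ξ (k + 2) ^ 2 * P k :=
    hJle.trans (mul_le_mul_of_nonneg_right (by gcongr) (hP0 k))
  have hIfin : I (k + 2) ≤ L ^ 2 * ξ (k + 2) ^ 2 * P (k + 1) / 2 :=
    (hIle (k + 1) (by omega)).trans
      (div_le_div_of_nonneg_right (mul_le_mul_of_nonneg_right (by gcongr) (hP0 _)) zero_le_two)
  set q := L ^ 2 * ξ (k + 2) ^ 2 with hq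
  have hq0 : 0 ≤ q := by positivity
  have hcomb : β * P k + (1 - β) * (P (k + 1) / 2) ≤ 9 * (5 - 3 * β) / 2 * S (k + 2) := by
    have h1 := mul_le_mul_of_nonneg_left (hPS k (by omega)) hβ0
    have h2 := mul_le_mul_of_nonneg_left (hPS (k + 1) (by omega)) hx
    have h3 := mul_le_mul_of_nonneg_left (hSmono (k + 1))
      (show 0 ≤ 10 / 3 * (2 - β) by linarith)
    have h4 : (10 / 3 * (2 - β) * (1 + (1 - β) / 2)) * S (k + 2) ≤
        9 * (5 - 3 * β) / 2 * S (k + 2) :=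
      mul_le_mul_of_nonneg_right (by nlinarith) (hS0 _)
    linarith
  calc β * J (k + 2) + (1 - β) * I (k + 2)
      ≤ β * (q * P k) + (1 - β) * (q * P (k + 1) / 2) := by gcongr
    _ = q * (β * P k + (1 - β) * (P (k + 1) / 2)) := by ring
    _ ≤ q * (9 * (5 - 3 * β) / 2 * S (k + 2)) := mul_le_mul_of_nonneg_left hcomb hq0
    _ = 9 * (5 - 3 * β) * L ^ 2 * ξ (k + 2) ^ 2 / 2 * S (k + 2) := by rw [hq]; ring
    _ ≤ _ := mul_le_mul_of_nonneg_left hSle (by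
        have : 0 ≤ 5 - 3 * β := by linarith
        positivity)
end

section
/- Under assumptions (a)–(c) and the SMG iterates driven by randomized reshuffling, fix T ≥ 1 and choose the constant learning rate η_t := γ·n^{1/3}/T^{1/3} for some γ > 0 such that γ·n^{1/3}/T^{1/3} ≤ 1/(L·√D), where D := max{5/3, 6(5−3β)(Θ+n)/(n(1−β))}. Then (1/Σ_{t=1}^T η_t) · Σ_{t=1}^T η_t·𝔼[‖∇F(w̃_{t−1})‖²] ≤ (1/(n^{1/3}·T^{2/3})) · ( 4·(F(w̃_0) − F_*)/((1−β)·γ) + 6·σ²·(5−3β)·L²·γ²/(1−β) ). -/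
open Finset

section GradientLemmas

variable {E : Type*} [NormedAddCommGroup E] [InnerProductSpace ℝ E]

/-- The quadratic upper bound satisfied by a function with Lipschitz gradient. -/
theorem le_add_inner_gradient_add_sq [CompleteSpace E] {F : E → ℝ} (hF : Differentiable ℝ F) {L : ℝ}
    (hL : ∀ x y, ‖gradient F x - gradient F y‖ ≤ L * ‖x - y‖) (x y : E) :
    F y ≤ F x + inner ℝ (gradient F x) (y - x) + L / 2 * ‖y - x‖ ^ 2 := by
  set φ : ℝ → ℝ := fun t => F (x + t • (y - x)) - t * inner ℝ (gradient F x) (y - x)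
    - L / 2 * ‖y - x‖ ^ 2 * t ^ 2 with hφ
  have hd : ∀ t, HasDerivAt φ (inner ℝ (gradient F (x + t • (y - x))) (y - x)
      - inner ℝ (gradient F x) (y - x) - L / 2 * ‖y - x‖ ^ 2 * (2 * t)) t := by
    intro t
    have hline : HasDerivAt (fun t : ℝ => x + t • (y - x)) (y - x) t := by
      simpa using ((hasDerivAt_id t).smul_const (y - x)).const_add x
    have hcomp := (hF (x + t • (y - x))).hasGradientAt.hasFDerivAt.comp_hasDerivAt t hline
    have hlin := (hasDerivAt_id t).mul_const (inner ℝ (gradient F x) (y - x))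
    have hsq := ((hasDerivAt_id t).pow 2).const_mul (L / 2 * ‖y - x‖ ^ 2)
    exact ((hcomp.sub hlin).sub hsq).congr_deriv (by simp)
  have hanti : AntitoneOn φ (Set.Icc 0 1) := by
    refine antitoneOn_of_deriv_nonpos (convex_Icc 0 1)
      (fun t _ => (hd t).continuousAt.continuousWithinAt)
      (fun t _ => (hd t).differentiableAt.differentiableWithinAt) ?_
    intro t ht
    rw [interior_Icc] at ht
    rw [(hd t).deriv, ← inner_sub_left]
    have h₁ := real_inner_le_norm (gradient F (x + t • (y - x)) - gradient F x) (y - x)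
    have h₂ := hL (x + t • (y - x)) x
    rw [add_sub_cancel_left, norm_smul, Real.norm_of_nonneg ht.1.le] at h₂
    nlinarith [mul_le_mul_of_nonneg_right h₂ (norm_nonneg (y - x))]
  have h := hanti (Set.left_mem_Icc.2 zero_le_one) (Set.right_mem_Icc.2 zero_le_one) zero_le_one
  simp only [hφ, one_smul, zero_smul, add_sub_cancel, add_zero] at h
  linarith

/-- One step with direction `p` decreases a function with Lipschitz gradient, up to the error of
`p` as an estimate of the gradient. -/
theorem gradient_step_le [CompleteSpace E] {F : E → ℝ} (hF : Differentiable ℝ F) {L : ℝ}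
    (hL : ∀ x y, ‖gradient F x - gradient F y‖ ≤ L * ‖x - y‖) (x p : E) (η : ℝ) :
    F (x - η • p) ≤ F x - η / 2 * ‖gradient F x‖ ^ 2 - η * (1 - L * η) / 2 * ‖p‖ ^ 2
      + η / 2 * ‖gradient F x - p‖ ^ 2 := by
  have h := le_add_inner_gradient_add_sq hF hL x (x - η • p)
  rw [sub_sub_cancel_left, norm_neg, norm_smul, inner_neg_right, real_inner_smul_right, mul_pow,
    Real.norm_eq_abs, sq_abs] at h
  rw [norm_sub_sq_real]
  linarith

theorem norm_sum_sq_le_card_mul {V ι : Type*} [SeminormedAddCommGroup V] (s : Finset ι) (u : ι → V) :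
    ‖∑ i ∈ s, u i‖ ^ 2 ≤ #s * ∑ i ∈ s, ‖u i‖ ^ 2 :=
  (pow_le_pow_left₀ (norm_nonneg _) (norm_sum_le _ _) 2).trans sq_sum_le_card_mul_sum_sq

theorem norm_convexCombination_sq_le {β : ℝ} (h₀ : 0 ≤ β) (h₁ : β ≤ 1) (a b : E) :
    ‖β • a + (1 - β) • b‖ ^ 2 ≤ β * ‖a‖ ^ 2 + (1 - β) * ‖b‖ ^ 2 := by
  have h := norm_add_sq_real (β • a) ((1 - β) • b)
  have h' := norm_sub_sq_real a b
  rw [real_inner_smul_left, real_inner_smul_right, norm_smul, norm_smul, mul_pow, mul_pow,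
    Real.norm_eq_abs, Real.norm_eq_abs, sq_abs, sq_abs] at h
  nlinarith [mul_nonneg (mul_nonneg h₀ (sub_nonneg.2 h₁)) (sq_nonneg ‖a - b‖)]

theorem norm_add_sq_le_two (a b : E) : ‖a + b‖ ^ 2 ≤ 2 * (‖a‖ ^ 2 + ‖b‖ ^ 2) := by
  have h := parallelogram_law_with_norm ℝ a b
  nlinarith [sq_nonneg ‖a - b‖]

theorem norm_add_add_sq_le_three {V : Type*} [SeminormedAddCommGroup V] (a b c : V) :
    ‖a + b + c‖ ^ 2 ≤ 3 * (‖a‖ ^ 2 + ‖b‖ ^ 2 + ‖c‖ ^ 2) := by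
  have h := norm_sum_sq_le_card_mul univ ![a, b, c]
  simpa [Fin.sum_univ_three] using h

end GradientLemmas

section Sampling

variable {E : Type*} [NormedAddCommGroup E] [InnerProductSpace ℝ E]
  {Ω : Type*} [Fintype Ω] {n : ℕ}

/-- Suppose `e τ` is a family of bijections of `Ω` which multiply the permutation `p ω` by `τ` on
the right. Then the entry `p ω j` is uniformly distributed, given any data invariant under `e`. -/
theorem card_mul_sum_apply_eq (p : Ω → Equiv.Perm (Fin n)) (e : Equiv.Perm (Fin n) → Equiv.Perm Ω)
    (hp : ∀ τ ω, p (e τ ω) = p ω * τ) (h : Ω → Fin n → ℝ) (hh : ∀ τ ω, h (e τ ω) = h ω)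
    (j : Fin n) : n * ∑ ω, h ω (p ω j) = ∑ ω, ∑ l, h ω l := by
  have hconst : ∀ k, ∑ ω, h ω (p ω k) = ∑ ω, h ω (p ω j) := fun k => by
    rw [← Equiv.sum_comp (e (Equiv.swap j k))]
    simp [hp, hh]
  calc (n : ℝ) * ∑ ω, h ω (p ω j) = ∑ k, ∑ ω, h ω (p ω k) := by simp [hconst]
    _ = ∑ ω, ∑ l, h ω l := by
      rw [sum_comm]
      exact sum_congr rfl fun ω _ => Equiv.sum_comp (p ω) (h ω)

/-- Distinct samples drawn without replacement from a centred population are negatively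
correlated. -/
theorem sum_inner_apply_nonpos (p : Ω → Equiv.Perm (Fin n))
    (e : Equiv.Perm (Fin n) → Equiv.Perm Ω) (hp : ∀ τ ω, p (e τ ω) = p ω * τ)
    (a : Ω → Fin n → E) (ha : ∀ τ ω, a (e τ ω) = a ω) (hcentred : ∀ ω, ∑ l, a ω l = 0)
    {j k : Fin n} (hjk : j ≠ k) : ∑ ω, inner ℝ (a ω (p ω j)) (a ω (p ω k)) ≤ 0 := by
  have hconst : ∀ i ∈ univ.erase j, ∑ ω, inner ℝ (a ω (p ω j)) (a ω (p ω i))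
      = ∑ ω, inner ℝ (a ω (p ω j)) (a ω (p ω k)) := fun i hi => by
    rw [← Equiv.sum_comp (e (Equiv.swap i k))]
    simp [hp, ha, Equiv.swap_apply_of_ne_of_ne (ne_of_mem_erase hi).symm hjk]
  have htotal : ∑ i, ∑ ω, inner ℝ (a ω (p ω j)) (a ω (p ω i)) = 0 := by
    rw [sum_comm]
    refine sum_eq_zero fun ω _ => ?_
    rw [← inner_sum, Equiv.sum_comp (p ω) (a ω), hcentred, inner_zero_right]
  rw [← add_sum_erase _ _ (mem_univ j), sum_congr rfl hconst, sum_const, nsmul_eq_mul] at htotal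
  have hdiag : 0 ≤ ∑ ω, inner ℝ (a ω (p ω j)) (a ω (p ω j)) :=
    sum_nonneg fun ω _ => real_inner_self_nonneg
  have hcard : (0 : ℝ) < #(univ.erase j) :=
    Nat.cast_pos.2 (card_pos.2 ⟨k, mem_erase.2 ⟨hjk.symm, mem_univ k⟩⟩)
  by_contra! hpos
  linarith [mul_pos hcard hpos]

/-- Variance of a sum of samples drawn without replacement from a centred population. -/
theorem card_mul_sum_norm_sum_sq_le (p : Ω → Equiv.Perm (Fin n))
    (e : Equiv.Perm (Fin n) → Equiv.Perm Ω) (hp : ∀ τ ω, p (e τ ω) = p ω * τ)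
    (a : Ω → Fin n → E) (ha : ∀ τ ω, a (e τ ω) = a ω) (hcentred : ∀ ω, ∑ l, a ω l = 0)
    (s : Finset (Fin n)) :
    n * ∑ ω, ‖∑ j ∈ s, a ω (p ω j)‖ ^ 2 ≤ #s * ∑ ω, ∑ l, ‖a ω l‖ ^ 2 := by
  have hexpand : ∑ ω, ‖∑ j ∈ s, a ω (p ω j)‖ ^ 2
      = ∑ j ∈ s, ∑ k ∈ s, ∑ ω, inner ℝ (a ω (p ω j)) (a ω (p ω k)) := by
    simp_rw [← real_inner_self_eq_norm_sq, sum_inner, inner_sum]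
    rw [sum_comm]
    exact sum_congr rfl fun j _ => sum_comm
  have hrow : ∀ j ∈ s, ∑ k ∈ s, ∑ ω, inner ℝ (a ω (p ω j)) (a ω (p ω k))
      ≤ ∑ ω, ‖a ω (p ω j)‖ ^ 2 := fun j hj => by
    rw [← add_sum_erase _ _ hj]
    simp_rw [real_inner_self_eq_norm_sq]
    linarith [sum_nonpos fun k (hk : k ∈ s.erase j) =>
      sum_inner_apply_nonpos p e hp a ha hcentred (ne_of_mem_erase hk).symm]
  calc n * ∑ ω, ‖∑ j ∈ s, a ω (p ω j)‖ ^ 2 ≤ n * ∑ j ∈ s, ∑ ω, ‖a ω (p ω j)‖ ^ 2 := by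
        rw [hexpand]
        gcongr with j hj
        exact hrow j hj
    _ = #s * ∑ ω, ∑ l, ‖a ω l‖ ^ 2 := by
        rw [mul_sum, sum_congr rfl fun j _ => card_mul_sum_apply_eq p e hp
          (fun ω l => ‖a ω l‖ ^ 2) (fun τ ω => by simp [ha]) j, sum_const, nsmul_eq_mul]

end Sampling

section Recursion

theorem sum_range_le_add_sum_range {a b : ℕ → ℝ} {T : ℕ} {A : ℝ} (hb : ∀ s < T, 0 ≤ b s)
    (h0 : a 0 ≤ A) (hA : 0 ≤ A) (hstep : ∀ s, s + 1 < T → a (s + 1) ≤ b s) :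
    ∑ s ∈ range T, a s ≤ A + ∑ s ∈ range T, b s := by
  cases T with
  | zero => simpa using hA
  | succ T =>
    rw [sum_range_succ', sum_range_succ]
    have := sum_le_sum fun s (hs : s ∈ range T) => hstep s (by simpa using hs)
    linarith [hb T (by omega)]

theorem momentum_recursion_bound {T : ℕ} (hT : 1 ≤ T) {η L β x K c : ℝ} (hη : 0 < η)
    (hL : 0 < L) (hβ0 : 0 ≤ β) (hβ1 : β < 1) (hx : x = L ^ 2 * η ^ 2) (hx30 : x ≤ 1 / 30)
    (hK : 1 ≤ K) (hxK : x * K ≤ (1 - β) / 12) (hc : 0 ≤ c) {k U q S r Φ : ℕ → ℝ}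
    (hk : ∀ s < T, 0 ≤ k s) (hU : ∀ s < T, 0 ≤ U s) (hS : ∀ s < T, 0 ≤ S s)
    (hq0 : q 0 = 0) (hq : ∀ s < T, q (s + 1) ≤ 2 * (U s + k s))
    (hUle : ∀ s < T, U s ≤ x * (β / 2 * q s + 3 / 2 * (1 - β) * (U s + K * k s + c)))
    (hΦ : ∀ s < T, Φ (s + 1) ≤ Φ s - η / 2 * k s - η * (1 - L * η) / 2 * S s
      + η / 2 * (β * r s + (1 - β) * U s))
    (hr0 : r 0 = k 0) (hr : ∀ s < T, r (s + 1) ≤ 2 * U s + 2 * x * S s) :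
    (1 - β) / 4 * ∑ s ∈ range T, k s ≤ (Φ 0 - Φ T) / η + 3 * x * (T * c) := by
  have hx0 : 0 ≤ x := by rw [hx]; positivity
  have hQ : ∑ s ∈ range T, q s ≤ 0 + ∑ s ∈ range T, 2 * (U s + k s) :=
    sum_range_le_add_sum_range (fun s hs => by linarith [hU s hs, hk s hs]) hq0.le le_rfl
      fun s hs => hq s (by omega)
  have hR : ∑ s ∈ range T, r s ≤ k 0 + ∑ s ∈ range T, (2 * U s + 2 * x * S s) :=
    sum_range_le_add_sum_range
      (fun s hs => by nlinarith [hU s hs, mul_nonneg hx0 (hS s hs)]) hr0.le (hk 0 hT)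
      fun s hs => hr s (by omega)
  have hk0 : k 0 ≤ ∑ s ∈ range T, k s :=
    single_le_sum (fun s hs => hk s (mem_range.1 hs)) (mem_range.2 hT)
  have hB := sum_le_sum fun s (hs : s ∈ range T) => hUle s (mem_range.1 hs)
  have hdesc := sum_le_sum fun s (hs : s ∈ range T) =>
    sub_le_sub_right (hΦ s (mem_range.1 hs)) (Φ s)
  rw [sum_range_sub] at hdesc
  have hdesc' : Φ T - Φ 0 ≤ - (η / 2 * ∑ s ∈ range T, k s)
      - η * (1 - L * η) / 2 * ∑ s ∈ range T, S s
      + η / 2 * (β * ∑ s ∈ range T, r s + (1 - β) * ∑ s ∈ range T, U s) := by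
    refine hdesc.trans_eq ?_
    simp only [mul_sum, ← sum_add_distrib, ← sum_sub_distrib, ← sum_neg_distrib]
    exact sum_congr rfl fun s _ => by ring
  have hB' : ∑ s ∈ range T, U s ≤ x * (β / 2 * ∑ s ∈ range T, q s
      + 3 / 2 * (1 - β) * (∑ s ∈ range T, U s + K * ∑ s ∈ range T, k s + T * c)) := by
    refine hB.trans_eq ?_
    rw [← mul_sum, sum_add_distrib, ← mul_sum, ← mul_sum, sum_add_distrib, sum_add_distrib,
      ← mul_sum, sum_const, card_range, nsmul_eq_mul]
  rw [zero_add, ← mul_sum, sum_add_distrib] at hQ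
  rw [sum_add_distrib, ← mul_sum, ← mul_sum] at hR
  have hA0 := sum_nonneg fun s (hs : s ∈ range T) => hk s (mem_range.1 hs)
  have hB0 := sum_nonneg fun s (hs : s ∈ range T) => hU s (mem_range.1 hs)
  have hS0 := sum_nonneg fun s (hs : s ∈ range T) => hS s (mem_range.1 hs)
  have hC0 : 0 ≤ T * c := by positivity
  clear hdesc hB
  generalize ∑ s ∈ range T, k s = A at *
  generalize ∑ s ∈ range T, U s = B at *
  generalize ∑ s ∈ range T, S s = Z at *
  generalize ∑ s ∈ range T, q s = Q at *
  generalize ∑ s ∈ range T, r s = R at *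
  generalize (T : ℝ) * c = C at *
  have hBbound : B ≤ (1 - β) / 4 * A + 3 * x * C := by
    have h₁ : β / 2 * Q + 3 / 2 * (1 - β) * (B + K * A + C) ≤ 3 / 2 * (B + K * A + C) := by
      have hKA : A ≤ K * A := le_mul_of_one_le_left hA0 hK
      nlinarith [mul_le_mul_of_nonneg_left hQ hβ0, mul_le_mul_of_nonneg_left hKA hβ0,
        mul_nonneg hβ0 hB0, mul_nonneg hβ0 hC0, mul_nonneg hβ0 hA0]
    have h₂ := mul_le_mul_of_nonneg_left h₁ hx0
    have h₃ := mul_le_mul_of_nonneg_right hxK hA0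
    have h₄ := mul_le_mul_of_nonneg_right hx30 hB0
    nlinarith [mul_nonneg hx0 hC0, mul_nonneg (sub_nonneg.2 hβ1.le) hA0]
  have hLη : L * η ≤ 1 / 2 := by nlinarith [mul_pos hL hη]
  have hSZ : 2 * x * Z * β ≤ (1 - L * η) * Z := by
    have h₁ : 2 * x * β ≤ 1 - L * η := by nlinarith
    nlinarith [mul_le_mul_of_nonneg_right h₁ hS0]
  have hmain : (1 - β) / 2 * A ≤ (Φ 0 - Φ T) / η + B := by
    have h₁ : 1 / 2 * A + (1 - L * η) / 2 * Z ≤ (Φ 0 - Φ T) / η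
        + 1 / 2 * (β * R + (1 - β) * B) := by
      rw [← sub_le_iff_le_add, le_div_iff₀ hη]
      nlinarith
    nlinarith [mul_le_mul_of_nonneg_left (hR.trans (add_le_add_left hk0 _)) hβ0,
      mul_nonneg (sub_nonneg.2 hβ1.le) hB0]
  linarith

end Recursion
section Epoch

variable {E : Type*} [NormedAddCommGroup E] [InnerProductSpace ℝ E] {n : ℕ}

theorem sum_filter_val_lt_succ {M : Type*} [AddCommMonoid M] (g : Fin n → M) {i : ℕ} (hi : i < n) :
    ∑ j with j.val < i + 1, g j = ∑ j with j.val < i, g j + g ⟨i, hi⟩ := by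
  have hins : (univ.filter fun j : Fin n => j.val < i + 1)
      = insert ⟨i, hi⟩ (univ.filter fun j : Fin n => j.val < i) := by
    ext j
    simp only [mem_filter, mem_univ, true_and, mem_insert, Fin.ext_iff]
    omega
  rw [hins, sum_insert (by simp), add_comm]

theorem sum_val_le_half_sq : ∑ i : Fin n, (i.val : ℝ) ≤ (n : ℝ) ^ 2 / 2 := by
  rw [Fin.sum_univ_eq_sum_range (fun i : ℕ => (i : ℝ)) n]
  have h : ∀ m : ℕ, ∑ i ∈ range m, (i : ℝ) = (m * (m - 1) : ℝ) / 2 := fun m => by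
    induction m with
    | zero => simp
    | succ m ih => rw [sum_range_succ, ih]; push_cast; ring
  rw [h]
  nlinarith [(Nat.cast_nonneg n : (0 : ℝ) ≤ n)]

/-- Unrolled form of the inner loop of one epoch with momentum `M` and gradients `g`. -/
theorem epoch_iterate_sub (w : ℕ → E) (g : Fin n → E) (M : E) (η β : ℝ)
    (hw : ∀ i (hi : i < n), w (i + 1) = w i - (η / n) • (β • M + (1 - β) • g ⟨i, hi⟩))
    {i : ℕ} (hi : i ≤ n) :
    w i - w 0 = -((η / n) • (β • ((i : ℝ) • M) + (1 - β) • ∑ j with j.val < i, g j)) := by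
  induction i with
  | zero => simp
  | succ i ih =>
    have hstep := ih (by omega)
    rw [sum_filter_val_lt_succ g (by omega), hw i (by omega),
      sub_right_comm, hstep]
    push_cast
    module

theorem epoch_last_sub (hn : 1 ≤ n) (w : ℕ → E) (g : Fin n → E) (M : E) (η β : ℝ)
    (hw : ∀ i (hi : i < n), w (i + 1) = w i - (η / n) • (β • M + (1 - β) • g ⟨i, hi⟩)) :
    w n - w 0 = -(η • (β • M + (1 - β) • ((n : ℝ)⁻¹ • ∑ j, g j))) := by
  have hn' : (n : ℝ) ≠ 0 := by positivity
  rw [epoch_iterate_sub w g M η β hw le_rfl, filter_true_of_mem fun j _ => j.isLt]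
  congr 1
  match_scalars <;> field_simp

/-- The averaged gradients of one epoch estimate the mean gradient at any point `z`, up to the
distance of the iterates to `z`. -/
theorem norm_mean_sub_sq_le (hn : 1 ≤ n) {G : Fin n → E → E} {L : ℝ}
    (hG : ∀ i x y, ‖G i x - G i y‖ ≤ L * ‖x - y‖) (p : Equiv.Perm (Fin n)) (w : ℕ → E) (z : E) :
    ‖(n : ℝ)⁻¹ • ∑ l, G l z - (n : ℝ)⁻¹ • ∑ j, G (p j) (w j)‖ ^ 2
      ≤ L ^ 2 / n * ∑ j : Fin n, ‖w j - z‖ ^ 2 := by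
  have hn' : (0 : ℝ) < n := by positivity
  rw [← Equiv.sum_comp p fun l => G l z, ← smul_sub, ← sum_sub_distrib, norm_smul, mul_pow,
    Real.norm_of_nonneg (by positivity)]
  have h₁ := norm_sum_sq_le_card_mul univ fun j : Fin n => G (p j) z - G (p j) (w j)
  have h₂ : ∑ j : Fin n, ‖G (p j) z - G (p j) (w j)‖ ^ 2
      ≤ L ^ 2 * ∑ j : Fin n, ‖w j - z‖ ^ 2 := by
    rw [mul_sum]
    refine sum_le_sum fun j _ => ?_
    rw [← mul_pow, norm_sub_rev (w j)]
    exact pow_le_pow_left₀ (norm_nonneg _) (hG _ _ _) 2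
  rw [card_univ, Fintype.card_fin] at h₁
  calc (n : ℝ)⁻¹ ^ 2 * ‖∑ j, (G (p j) z - G (p j) (w j))‖ ^ 2
      ≤ (n : ℝ)⁻¹ ^ 2 * (n * (L ^ 2 * ∑ j : Fin n, ‖w j - z‖ ^ 2)) := by
        gcongr
        exact h₁.trans (by gcongr)
    _ = L ^ 2 / n * ∑ j : Fin n, ‖w j - z‖ ^ 2 := by field_simp

theorem norm_partialSum_sq_le {G : Fin n → E → E} {L : ℝ}
    (hG : ∀ i x y, ‖G i x - G i y‖ ≤ L * ‖x - y‖) (p : Equiv.Perm (Fin n)) (w : ℕ → E) (μ : E)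
    (i : Fin n) :
    ‖∑ j with j.val < i.val, G (p j) (w j)‖ ^ 2
      ≤ 3 * (i * (L ^ 2 * ∑ j : Fin n, ‖w j - w 0‖ ^ 2)
        + ‖∑ j with j.val < i.val, (G (p j) (w 0) - μ)‖ ^ 2 + i * n * ‖μ‖ ^ 2) := by
  have hcard : #(univ.filter fun j : Fin n => j.val < i.val) = i.val := by
    rw [show (univ.filter fun j : Fin n => j.val < i.val) = Iio i by ext; simp, Fin.card_Iio]
  have hsplit : ∑ j with j.val < i.val, G (p j) (w j)
      = ∑ j with j.val < i.val, (G (p j) (w j) - G (p j) (w 0))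
        + ∑ j with j.val < i.val, (G (p j) (w 0) - μ) + (i.val : ℝ) • μ := by
    rw [sum_sub_distrib, sum_sub_distrib, sum_const, hcard, Nat.cast_smul_eq_nsmul]
    abel
  have hlip : ‖∑ j with j.val < i.val, (G (p j) (w j) - G (p j) (w 0))‖ ^ 2
      ≤ i * (L ^ 2 * ∑ j : Fin n, ‖w j - w 0‖ ^ 2) := by
    refine (norm_sum_sq_le_card_mul _ _).trans ?_
    rw [hcard]
    gcongr
    rw [mul_sum]
    refine (sum_le_sum fun j _ => ?_).trans
      (sum_le_sum_of_subset_of_nonneg (filter_subset _ _) fun j _ _ => by positivity)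
    rw [← mul_pow]
    exact pow_le_pow_left₀ (norm_nonneg _) (hG _ _ _) 2
  have hmean : ‖(i.val : ℝ) • μ‖ ^ 2 ≤ i * n * ‖μ‖ ^ 2 := by
    rw [norm_smul, mul_pow, Real.norm_of_nonneg (by positivity), sq (i.val : ℝ)]
    gcongr
    exact i.isLt.le
  rw [hsplit]
  refine (norm_add_add_sq_le_three _ _ _).trans ?_
  gcongr

/-- Drift of the iterates within one epoch, in terms of the momentum `M`, a reference gradient `μ`
and the deviations of the sampled gradients from `μ`. -/
theorem epoch_drift_le (hn : 1 ≤ n) {G : Fin n → E → E} {L : ℝ}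
    (hG : ∀ i x y, ‖G i x - G i y‖ ≤ L * ‖x - y‖) (p : Equiv.Perm (Fin n)) (w : ℕ → E) (M μ : E)
    (η : ℝ) {β : ℝ} (hβ0 : 0 ≤ β) (hβ1 : β ≤ 1)
    (hw : ∀ i (hi : i < n), w (i + 1)
      = w i - (η / n) • (β • M + (1 - β) • G (p ⟨i, hi⟩) (w i))) :
    L ^ 2 / n * ∑ i : Fin n, ‖w i - w 0‖ ^ 2 ≤ L ^ 2 * η ^ 2 * (β / 2 * ‖M‖ ^ 2
      + 3 / 2 * (1 - β) * (L ^ 2 / n * ∑ i : Fin n, ‖w i - w 0‖ ^ 2 + ‖μ‖ ^ 2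
        + 2 / n ^ 3 * ∑ i : Fin n, ‖∑ j with j.val < i.val, (G (p j) (w 0) - μ)‖ ^ 2)) := by
  have hn' : (0 : ℝ) < n := by positivity
  have hβ' : 0 ≤ 1 - β := sub_nonneg.2 hβ1
  set W := ∑ i : Fin n, ‖w i - w 0‖ ^ 2 with hW
  set P : Fin n → ℝ := fun i => ‖∑ j with j.val < i.val, (G (p j) (w 0) - μ)‖ ^ 2 with hP
  have hW0 : 0 ≤ W := sum_nonneg fun i _ => by positivity
  have hterm : ∀ i : Fin n, ‖w i - w 0‖ ^ 2 ≤ (η / n) ^ 2 * (i * (β * n * ‖M‖ ^ 2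
      + (1 - β) * (3 * (L ^ 2 * W + n * ‖μ‖ ^ 2))) + 3 * (1 - β) * P i) := fun i => by
    rw [epoch_iterate_sub w (fun j => G (p j) (w j)) M η β hw i.isLt.le, norm_neg, norm_smul,
      mul_pow, Real.norm_eq_abs, sq_abs]
    gcongr
    refine (norm_convexCombination_sq_le hβ0 hβ1 _ _).trans ?_
    have h₁ := mul_le_mul_of_nonneg_left (norm_partialSum_sq_le hG p w μ i) hβ'
    have h₂ : ‖(i.val : ℝ) • M‖ ^ 2 ≤ i * n * ‖M‖ ^ 2 := by
      rw [norm_smul, mul_pow, Real.norm_of_nonneg (by positivity), sq (i.val : ℝ)]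
      gcongr
      exact i.isLt.le
    have h₃ := mul_le_mul_of_nonneg_left h₂ hβ0
    simp only [hP]
    linarith
  have hsum : W ≤ (η / n) ^ 2 * ((n : ℝ) ^ 2 / 2 * (β * n * ‖M‖ ^ 2
      + (1 - β) * (3 * (L ^ 2 * W + n * ‖μ‖ ^ 2))) + 3 * (1 - β) * ∑ i, P i) := by
    refine (sum_le_sum fun i _ => hterm i).trans ?_
    rw [← mul_sum, sum_add_distrib, ← sum_mul, ← mul_sum]
    gcongr
    exact sum_val_le_half_sq
  calc L ^ 2 / n * W ≤ L ^ 2 / n * ((η / n) ^ 2 * ((n : ℝ) ^ 2 / 2 * (β * n * ‖M‖ ^ 2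
      + (1 - β) * (3 * (L ^ 2 * W + n * ‖μ‖ ^ 2))) + 3 * (1 - β) * ∑ i, P i)) := by gcongr
    _ = _ := by field_simp; ring

end Epoch

section MomentumReshuffling

variable {E : Type*} [NormedAddCommGroup E] [InnerProductSpace ℝ E]

/-- The state after `s` epochs depends only on the first `s` permutations. -/
theorem smg_state_congr {n T : ℕ} {G : Fin n → E → E} {η β : ℝ} {x₀ y₀ : E}
    {w : (Fin T → Equiv.Perm (Fin n)) → ℕ → ℕ → E} {x y : (Fin T → Equiv.Perm (Fin n)) → ℕ → E}
    (hx0 : ∀ ω, x ω 0 = x₀) (hy0 : ∀ ω, y ω 0 = y₀)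
    (hw0 : ∀ ω s, s < T → w ω s 0 = x ω s)
    (hw : ∀ ω s (hs : s < T) i (hi : i < n), w ω s (i + 1)
      = w ω s i - (η / n) • (β • y ω s + (1 - β) • G (ω ⟨s, hs⟩ ⟨i, hi⟩) (w ω s i)))
    (hx : ∀ ω s, s < T → x ω (s + 1) = w ω s n)
    (hy : ∀ ω s (hs : s < T), y ω (s + 1) = (n : ℝ)⁻¹ • ∑ j : Fin n, G (ω ⟨s, hs⟩ j) (w ω s j))
    {s : ℕ} (hs : s ≤ T) {ω ω' : Fin T → Equiv.Perm (Fin n)}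
    (hω : ∀ t : Fin T, t.val < s → ω t = ω' t) : x ω s = x ω' s ∧ y ω s = y ω' s := by
  induction s with
  | zero => simp [hx0, hy0]
  | succ s ih =>
    obtain ⟨hxs, hys⟩ := ih (by omega) fun t ht => hω t (by omega)
    have hp : ω ⟨s, hs⟩ = ω' ⟨s, hs⟩ := hω _ (Nat.lt_succ_self s)
    have hinner : ∀ i ≤ n, w ω s i = w ω' s i := fun i hi => by
      induction i with
      | zero => rw [hw0 _ _ hs, hw0 _ _ hs, hxs]
      | succ i ihi => rw [hw _ _ hs i hi, hw _ _ hs i hi, ihi (by omega), hys, hp]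
    refine ⟨by rw [hx _ _ hs, hx _ _ hs, hinner n le_rfl], ?_⟩
    rw [hy _ _ hs, hy _ _ hs, hp]
    congr 1
    exact sum_congr rfl fun j _ => by rw [hinner j j.isLt.le]

variable [CompleteSpace E]

theorem gradient_mean {n : ℕ} {f : Fin n → E → ℝ} (hf : ∀ i, Differentiable ℝ (f i)) (x : E) :
    gradient (fun x => (1 / (n : ℝ)) * ∑ i, f i x) x = (n : ℝ)⁻¹ • ∑ i, gradient (f i) x := by
  have h := (HasFDerivAt.fun_sum fun i (_ : i ∈ univ) =>
    (hf i x).hasGradientAt.hasFDerivAt).const_mul (1 / (n : ℝ))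
  refine HasGradientAt.gradient (hasGradientAt_iff_hasFDerivAt.2 (h.congr_fderiv ?_))
  simp [map_smul, map_sum]

theorem smg_sum_gradient_sq_le {n T : ℕ} (hn : 1 ≤ n) (hT : 1 ≤ T) {f : Fin n → E → ℝ}
    (hf : ∀ i, Differentiable ℝ (f i)) {F : E → ℝ}
    (hF : F = fun x => (1 / (n : ℝ)) * ∑ i, f i x) {L : ℝ} (hL : 0 < L)
    (hsmooth : ∀ i x y, ‖gradient (f i) x - gradient (f i) y‖ ≤ L * ‖x - y‖)
    {Θ σ : ℝ} (hΘ : 0 ≤ Θ)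
    (hvar : ∀ x, (1 / (n : ℝ)) * ∑ i, ‖gradient (f i) x - gradient F x‖ ^ 2
        ≤ Θ * ‖gradient F x‖ ^ 2 + σ ^ 2)
    {Fstar : ℝ} (hFstar : ∀ x, Fstar ≤ F x) {β : ℝ} (hβ0 : 0 ≤ β) (hβ1 : β < 1)
    {η : ℝ} (hη : 0 < η) (hη30 : L ^ 2 * η ^ 2 ≤ 1 / 30)
    (hηΘ : L ^ 2 * η ^ 2 * ((Θ + n) / n) ≤ (1 - β) / 12) {x₀ : E}
    {w : (Fin T → Equiv.Perm (Fin n)) → ℕ → ℕ → E} {x y : (Fin T → Equiv.Perm (Fin n)) → ℕ → E}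
    (hx0 : ∀ ω, x ω 0 = x₀) (hy0 : ∀ ω, y ω 0 = 0)
    (hw0 : ∀ ω s, s < T → w ω s 0 = x ω s)
    (hw : ∀ ω s (hs : s < T) i (hi : i < n), w ω s (i + 1) = w ω s i
      - (η / n) • (β • y ω s + (1 - β) • gradient (f (ω ⟨s, hs⟩ ⟨i, hi⟩)) (w ω s i)))
    (hx : ∀ ω s, s < T → x ω (s + 1) = w ω s n)
    (hy : ∀ ω s (hs : s < T), y ω (s + 1)
      = (n : ℝ)⁻¹ • ∑ j : Fin n, gradient (f (ω ⟨s, hs⟩ j)) (w ω s j)) :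
    (1 - β) / 4 * ∑ s ∈ range T, ∑ ω, ‖gradient F (x ω s)‖ ^ 2
      ≤ Fintype.card (Fin T → Equiv.Perm (Fin n)) * ((F x₀ - Fstar) / η
        + 3 * (L ^ 2 * η ^ 2) * (T * (σ ^ 2 / n))) := by
  have hn' : (0 : ℝ) < n := by positivity
  have hβ' : 0 ≤ 1 - β := by linarith
  have hgrad : ∀ z, gradient F z = (n : ℝ)⁻¹ • ∑ i, gradient (f i) z := fun z => by
    rw [hF, gradient_mean hf]
  have hFdiff : Differentiable ℝ F := by
    rw [hF]
    exact (Differentiable.fun_sum fun i _ => hf i).const_mul _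
  have hFsmooth : ∀ a b, ‖gradient F a - gradient F b‖ ≤ L * ‖a - b‖ := fun a b => by
    rw [hgrad, hgrad, ← smul_sub, ← sum_sub_distrib, norm_smul,
      Real.norm_of_nonneg (by positivity), inv_mul_le_iff₀ hn']
    refine (norm_sum_le _ _).trans ((sum_le_sum fun i _ => hsmooth i a b).trans_eq ?_)
    simp
  have hlast : ∀ ω s, s < T →
      x ω (s + 1) - x ω s = -(η • (β • y ω s + (1 - β) • y ω (s + 1))) := fun ω s hs => by
    rw [hx ω s hs, ← hw0 ω s hs, hy ω s hs]
    exact epoch_last_sub hn (w ω s) (fun j => gradient (f (ω ⟨s, hs⟩ j)) (w ω s j)) _ η β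
      (hw ω s hs)
  have herr : ∀ ω s, s < T → ∀ z, ‖gradient F z - y ω (s + 1)‖ ^ 2
      ≤ L ^ 2 / n * ∑ i : Fin n, ‖w ω s i - z‖ ^ 2 := fun ω s hs z => by
    rw [hgrad, hy ω s hs]
    exact norm_mean_sub_sq_le hn hsmooth _ (w ω s) z
  have hsampling : ∀ s (hs : s < T), 2 / (n : ℝ) ^ 3 * ∑ ω, ∑ i : Fin n,
      ‖∑ j with j.val < i.val, (gradient (f (ω ⟨s, hs⟩ j)) (x ω s) - gradient F (x ω s))‖ ^ 2
      ≤ ∑ ω, (Θ * ‖gradient F (x ω s)‖ ^ 2 + σ ^ 2) / n := fun s hs => by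
    set V := ∑ ω, (Θ * ‖gradient F (x ω s)‖ ^ 2 + σ ^ 2) with hV
    have hV0 : 0 ≤ V := sum_nonneg fun ω _ => by positivity
    have hpop : ∑ ω, ∑ l, ‖gradient (f l) (x ω s) - gradient F (x ω s)‖ ^ 2 ≤ n * V := by
      rw [hV, mul_sum]
      refine sum_le_sum fun ω _ => ?_
      have h := hvar (x ω s)
      rwa [one_div, inv_mul_le_iff₀ hn'] at h
    have hinv : ∀ (τ : Equiv.Perm (Fin n)) (ω : Fin T → Equiv.Perm (Fin n)),
        x (ω * Pi.mulSingle ⟨s, hs⟩ τ) s = x ω s := fun τ ω => by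
      refine (smg_state_congr (G := fun i => gradient (f i)) hx0 hy0 hw0 hw hx hy hs.le fun t ht => ?_).1
      have hne : t ≠ ⟨s, hs⟩ := fun h => by simp [h] at ht
      simp [Pi.mulSingle_eq_of_ne hne]
    have hrow : ∀ i : Fin n, ∑ ω, ‖∑ j with j.val < i.val,
        (gradient (f (ω ⟨s, hs⟩ j)) (x ω s) - gradient F (x ω s))‖ ^ 2 ≤ i * V := fun i => by
      have h := card_mul_sum_norm_sum_sq_le (fun ω : Fin T → Equiv.Perm (Fin n) => ω ⟨s, hs⟩)
        (fun τ => Equiv.mulRight (Pi.mulSingle ⟨s, hs⟩ τ)) (fun τ ω => by simp)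
        (fun ω l => gradient (f l) (x ω s) - gradient F (x ω s))
        (fun τ ω => by simp [hinv]) (fun ω => ?_) (univ.filter fun j => j.val < i.val)
      · rw [show (univ.filter fun j : Fin n => j.val < i.val) = Iio i by ext; simp,
          Fin.card_Iio] at h
        rw [show (univ.filter fun j : Fin n => j.val < i.val) = Iio i by ext; simp]
        refine le_of_mul_le_mul_left (h.trans ?_) hn'
        calc (i.val : ℝ) * _ ≤ i.val * (n * V) := by gcongr
          _ = n * (i * V) := by ring
      · rw [sum_sub_distrib, sum_const, card_univ, Fintype.card_fin, hgrad,
          ← Nat.cast_smul_eq_nsmul ℝ, smul_inv_smul₀ hn'.ne', sub_self]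
    rw [sum_comm, ← sum_div]
    calc 2 / (n : ℝ) ^ 3 * _ ≤ 2 / (n : ℝ) ^ 3 * ((n : ℝ) ^ 2 / 2 * V) := by
          gcongr
          refine (sum_le_sum fun i _ => hrow i).trans ?_
          rw [← sum_mul]
          gcongr
          exact sum_val_le_half_sq
      _ = V / n := by field_simp
  set N : ℝ := (Fintype.card (Fin T → Equiv.Perm (Fin n)) : ℝ) with hN
  have hN0 : 0 ≤ N := Nat.cast_nonneg _
  have hbound := momentum_recursion_bound hT hη hL hβ0 hβ1 rfl hη30
    (K := (Θ + n) / n) (c := N * (σ ^ 2 / n))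
    (k := fun s => ∑ ω, ‖gradient F (x ω s)‖ ^ 2)
    (U := fun s => ∑ ω, L ^ 2 / n * ∑ i : Fin n, ‖w ω s i - x ω s‖ ^ 2)
    (q := fun s => ∑ ω, ‖y ω s‖ ^ 2)
    (S := fun s => ∑ ω, ‖β • y ω s + (1 - β) • y ω (s + 1)‖ ^ 2)
    (r := fun s => ∑ ω, ‖gradient F (x ω s) - y ω s‖ ^ 2)
    (Φ := fun s => ∑ ω, F (x ω s))
    (by rw [le_div_iff₀ hn']; linarith) hηΘ (by positivity)
    (fun s _ => by positivity) (fun s _ => by positivity) (fun s _ => by positivity)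
    (by simp [hy0]) ?_ ?_ ?_ (by simp [hy0]) ?_
  · have hfinal : N * Fstar ≤ ∑ ω, F (x ω T) := by
      have h := card_nsmul_le_sum univ (fun ω => F (x ω T)) Fstar fun ω _ => hFstar _
      rwa [nsmul_eq_mul, card_univ] at h
    have hinit : ∑ ω, F (x ω 0) = N * F x₀ := by simp [hx0, hN]
    rw [hinit] at hbound
    refine hbound.trans ?_
    have h : (N * F x₀ - ∑ ω, F (x ω T)) / η ≤ N * ((F x₀ - Fstar) / η) := by
      rw [← mul_div_assoc]
      gcongr
      linarith
    linarith
  · intro s hs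
    rw [← sum_add_distrib, mul_sum]
    refine sum_le_sum fun ω _ => ?_
    have h := norm_add_sq_le_two (y ω (s + 1) - gradient F (x ω s)) (gradient F (x ω s))
    rw [sub_add_cancel, norm_sub_rev] at h
    linarith [herr ω s hs (x ω s)]
  · intro s hs
    have h := sum_le_sum fun ω (_ : ω ∈ univ) => epoch_drift_le hn hsmooth (ω ⟨s, hs⟩) (w ω s)
      (y ω s) (gradient F (x ω s)) η hβ0 hβ1.le (hw ω s hs)
    simp only [hw0 _ s hs] at h
    refine h.trans ?_
    rw [← mul_sum, sum_add_distrib, ← mul_sum, ← mul_sum, sum_add_distrib, sum_add_distrib,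
      ← mul_sum (f := fun ω => ∑ i : Fin n, ‖∑ j with j.val < i.val,
        (gradient (f (ω ⟨s, hs⟩ j)) (x ω s) - gradient F (x ω s))‖ ^ 2)]
    have h₁ := hsampling s hs
    rw [← sum_div, sum_add_distrib, ← mul_sum, sum_const, card_univ, nsmul_eq_mul, ← hN] at h₁
    refine mul_le_mul_of_nonneg_left (add_le_add_right
      (mul_le_mul_of_nonneg_left ?_ (by linarith)) _) (by positivity)
    rw [add_assoc, add_assoc]
    refine add_le_add_right ((add_le_add_right h₁ _).trans_eq ?_) _
    field_simp
    ring
  · intro s hs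
    simp only [mul_sum, ← sum_add_distrib, ← sum_sub_distrib]
    refine sum_le_sum fun ω _ => ?_
    have h := gradient_step_le hFdiff hFsmooth (x ω s) (β • y ω s + (1 - β) • y ω (s + 1)) η
    rw [← neg_add_eq_sub, ← hlast ω s hs, sub_add_cancel] at h
    have hconv := norm_convexCombination_sq_le hβ0 hβ1.le (gradient F (x ω s) - y ω s)
      (gradient F (x ω s) - y ω (s + 1))
    rw [show β • (gradient F (x ω s) - y ω s) + (1 - β) • (gradient F (x ω s) - y ω (s + 1))
      = gradient F (x ω s) - (β • y ω s + (1 - β) • y ω (s + 1)) by module] at hconv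
    have herr' := mul_le_mul_of_nonneg_left (herr ω s hs (x ω s)) hβ'
    refine h.trans ?_
    simp only [← mul_sum]
    gcongr
    linarith
  · intro s hs
    simp only [mul_sum, ← sum_add_distrib]
    refine sum_le_sum fun ω _ => (herr ω s hs (x ω (s + 1))).trans ?_
    have hstep : ‖x ω s - x ω (s + 1)‖ ^ 2
        = η ^ 2 * ‖β • y ω s + (1 - β) • y ω (s + 1)‖ ^ 2 := by
      rw [norm_sub_rev, hlast ω s hs, norm_neg, norm_smul, mul_pow, Real.norm_eq_abs, sq_abs]
    have hsum : ∑ i : Fin n, ‖w ω s i - x ω (s + 1)‖ ^ 2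
        ≤ 2 * (∑ i : Fin n, ‖w ω s i - x ω s‖ ^ 2 + n * ‖x ω s - x ω (s + 1)‖ ^ 2) := by
      refine (sum_le_sum fun i _ => ?_).trans_eq (b := ∑ i : Fin n,
        2 * (‖w ω s i - x ω s‖ ^ 2 + ‖x ω s - x ω (s + 1)‖ ^ 2)) ?_
      · rw [← sub_add_sub_cancel (w ω s i) (x ω s) (x ω (s + 1))]
        exact norm_add_sq_le_two _ _
      · rw [← mul_sum, sum_add_distrib, sum_const, card_univ, Fintype.card_fin, nsmul_eq_mul]
    rw [hstep] at hsum
    simp only [← mul_sum]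
    calc _ ≤ L ^ 2 / n * _ := mul_le_mul_of_nonneg_left hsum (by positivity)
      _ = _ := by field_simp

end MomentumReshuffling

theorem smg_rr_constant_lr
    (n d : ℕ) (hn : 1 ≤ n) (hd : 1 ≤ d)
    (f : Fin n → EuclideanSpace ℝ (Fin d) → ℝ)
    (hf : ∀ i, Differentiable ℝ (f i))
    (F : EuclideanSpace ℝ (Fin d) → ℝ)
    (hF : F = fun x => (1 / (n : ℝ)) * ∑ i, f i x)
    (L : ℝ) (hL : 0 < L)
    (hsmooth : ∀ i x y, ‖gradient (f i) x - gradient (f i) y‖ ≤ L * ‖x - y‖)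
    (Θ σ : ℝ) (hΘ : 0 ≤ Θ) (hσ : 0 ≤ σ)
    (hvar : ∀ x, (1 / (n : ℝ)) * ∑ i, ‖gradient (f i) x - gradient F x‖ ^ 2
        ≤ Θ * ‖gradient F x‖ ^ 2 + σ ^ 2)
    (Fstar : ℝ) (hFstar : IsGLB (Set.range F) Fstar)
    (T : ℕ) (hT : 1 ≤ T)
    (β : ℝ) (hβ0 : 0 ≤ β) (hβ1 : β < 1)
    (η : ℕ → ℝ) (hηpos : ∀ t, 1 ≤ t → t ≤ T → 0 < η t)
    (w0 : EuclideanSpace ℝ (Fin d))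
    (w m v g : (Fin T → Equiv.Perm (Fin n)) → ℕ → ℕ → EuclideanSpace ℝ (Fin d))
    (wt mt : (Fin T → Equiv.Perm (Fin n)) → ℕ → EuclideanSpace ℝ (Fin d))
    (hwt0 : ∀ ω, wt ω 0 = w0)
    (hmt0 : ∀ ω, mt ω 0 = 0)
    (hw0 : ∀ ω t, 1 ≤ t → t ≤ T → w ω t 0 = wt ω (t - 1))
    (hm0 : ∀ ω t, 1 ≤ t → t ≤ T → m ω t 0 = mt ω (t - 1))
    (hv0 : ∀ ω t, 1 ≤ t → t ≤ T → v ω t 0 = 0)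
    (hg : ∀ ω t, ∀ ht1 : 1 ≤ t, ∀ ht2 : t ≤ T, ∀ i, ∀ hi : i < n,
        g ω t i = gradient (f (ω ⟨t - 1, by omega⟩ ⟨i, hi⟩)) (w ω t i))
    (hm1 : ∀ ω t, 1 ≤ t → t ≤ T → ∀ i, i < n →
        m ω t (i + 1) = β • m ω t 0 + (1 - β) • g ω t i)
    (hv1 : ∀ ω t, 1 ≤ t → t ≤ T → ∀ i, i < n →
        v ω t (i + 1) = v ω t i + ((n : ℝ))⁻¹ • g ω t i)
    (hw1 : ∀ ω t, 1 ≤ t → t ≤ T → ∀ i, i < n →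
        w ω t (i + 1) = w ω t i - (η t / (n : ℝ)) • m ω t (i + 1))
    (hwtn : ∀ ω t, 1 ≤ t → t ≤ T → wt ω t = w ω t n)
    (hmtn : ∀ ω t, 1 ≤ t → t ≤ T → mt ω t = v ω t n)
    (D : ℝ)
    (hDdef : D = max (5 / 3) (6 * (5 - 3 * β) * (Θ + (n : ℝ)) / ((n : ℝ) * (1 - β))))
    (γ : ℝ) (hγ : 0 < γ)
    (hη : ∀ t, η t = γ * (n : ℝ) ^ ((1 : ℝ) / 3) / (T : ℝ) ^ ((1 : ℝ) / 3))
    (hηD : γ * (n : ℝ) ^ ((1 : ℝ) / 3) / (T : ℝ) ^ ((1 : ℝ) / 3) ≤ 1 / (L * Real.sqrt D)) :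
    (∑ t ∈ Icc 1 T, η t *
        ((Fintype.card (Fin T → Equiv.Perm (Fin n)) : ℝ)⁻¹ *
          ∑ ω : Fin T → Equiv.Perm (Fin n), ‖gradient F (wt ω (t - 1))‖ ^ 2))
      / (∑ t ∈ Icc 1 T, η t)
      ≤ (1 / ((n : ℝ) ^ ((1 : ℝ) / 3) * (T : ℝ) ^ ((2 : ℝ) / 3)))
          * (4 * (F w0 - Fstar) / ((1 - β) * γ)
            + 6 * σ ^ 2 * (5 - 3 * β) * L ^ 2 * γ ^ 2 / (1 - β)) := by
  have hn' : (0 : ℝ) < n := by positivity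
  have hT' : (0 : ℝ) < T := by positivity
  have hβ' : 0 < 1 - β := by linarith
  obtain ⟨ε, hε⟩ : ∃ ε, ε = γ * (n : ℝ) ^ ((1 : ℝ) / 3) / (T : ℝ) ^ ((1 : ℝ) / 3) := ⟨_, rfl⟩
  have hηε : ∀ t, η t = ε := fun t => (hη t).trans hε.symm
  rw [← hε] at hηD
  have hε0 : 0 < ε := by rw [hε]; positivity
  have hDpos : 0 < D := by rw [hDdef]; exact lt_max_of_lt_left (by norm_num)
  have hεD : L ^ 2 * ε ^ 2 * D ≤ 1 := by
    rw [le_div_iff₀ (by positivity)] at hηD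
    calc L ^ 2 * ε ^ 2 * D = (ε * (L * √D)) ^ 2 := by
          rw [mul_pow, mul_pow, Real.sq_sqrt hDpos.le]; ring
      _ ≤ 1 := pow_le_one₀ (by positivity) hηD
  have hεK : L ^ 2 * ε ^ 2 * ((Θ + n) / n) * (6 * (5 - 3 * β)) ≤ 1 - β := by
    have h : 6 * (5 - 3 * β) * (Θ + n) / (n * (1 - β)) ≤ D := hDdef ▸ le_max_right _ _
    have h' := (mul_le_mul_of_nonneg_left h (by positivity : 0 ≤ L ^ 2 * ε ^ 2)).trans hεD
    rw [← mul_div_assoc, div_le_one (by positivity)] at h'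
    rw [← mul_div_assoc, div_mul_eq_mul_div, div_le_iff₀ hn']
    linarith
  have hK : 1 ≤ (Θ + n) / n := by rw [le_div_iff₀ hn']; linarith
  have hx0 : 0 ≤ L ^ 2 * ε ^ 2 := by positivity
  have hxK : L ^ 2 * ε ^ 2 ≤ L ^ 2 * ε ^ 2 * ((Θ + n) / n) := le_mul_of_one_le_right hx0 hK
  have hε30 : L ^ 2 * ε ^ 2 ≤ 1 / 30 := by
    have h := mul_le_mul_of_nonneg_right hxK (by linarith : 0 ≤ 6 * (5 - 3 * β))
    by_contra! hlt
    nlinarith [mul_pos (sub_pos.2 hlt) (by linarith : 0 < 5 - 3 * β)]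
  have hεΘ : L ^ 2 * ε ^ 2 * ((Θ + n) / n) ≤ (1 - β) / 12 := by
    nlinarith [mul_nonneg (hx0.trans hxK) hβ'.le]
  have hvsum : ∀ ω t, 1 ≤ t → t ≤ T → ∀ i ≤ n,
      v ω t i = (n : ℝ)⁻¹ • ∑ j ∈ range i, g ω t j := fun ω t ht₁ ht₂ i hi => by
    induction i with
    | zero => simp [hv0 ω t ht₁ ht₂]
    | succ i ih => rw [hv1 ω t ht₁ ht₂ i hi, ih (by omega), sum_range_succ, smul_add]
  have hbound := smg_sum_gradient_sq_le hn hT hf hF hL hsmooth hΘ hvar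
    (fun x => hFstar.1 ⟨x, rfl⟩) hβ0 hβ1 hε0 hε30 hεΘ (w := fun ω s => w ω (s + 1)) hwt0 hmt0
    (fun ω s hs => hw0 ω (s + 1) (by omega) hs)
    (fun ω s hs i hi => by
      rw [hw1 ω (s + 1) (by omega) hs i hi, hm1 ω (s + 1) (by omega) hs i hi,
        hm0 ω (s + 1) (by omega) hs, hg ω (s + 1) (by omega) hs i hi, hηε]
      rfl)
    (fun ω s hs => hwtn ω (s + 1) (by omega) hs)
    (fun ω s hs => by
      rw [hmtn ω (s + 1) (by omega) hs, hvsum ω (s + 1) (by omega) hs n le_rfl,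
        ← Fin.sum_univ_eq_sum_range (fun j => g ω (s + 1) j) n]
      congr 1
      exact sum_congr rfl fun j _ => hg ω (s + 1) (by omega) hs j j.isLt)
  set N : ℝ := (Fintype.card (Fin T → Equiv.Perm (Fin n)) : ℝ) with hN
  have hN0 : 0 < N := Nat.cast_pos.2 Fintype.card_pos
  set A := ∑ s ∈ range T, ∑ ω, ‖gradient F (wt ω s)‖ ^ 2 with hA
  have hlhs : (∑ t ∈ Icc 1 T, η t * (N⁻¹ * ∑ ω, ‖gradient F (wt ω (t - 1))‖ ^ 2))
      / (∑ t ∈ Icc 1 T, η t) = N⁻¹ * A / T := by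
    have hshift : ∑ t ∈ Icc 1 T, ∑ ω, ‖gradient F (wt ω (t - 1))‖ ^ 2 = A := by
      rw [hA, range_eq_Ico, ← Ico_add_one_right_eq_Icc,
        ← sum_Ico_add' (fun t => ∑ ω, ‖gradient F (wt ω (t - 1))‖ ^ 2) 0 T 1]
      simp
    simp only [hηε]
    rw [← mul_sum, ← mul_sum, hshift, sum_const, Nat.card_Icc, nsmul_eq_mul, Nat.add_sub_cancel]
    field_simp
  have havg : N⁻¹ * A / T ≤ 4 * (F w0 - Fstar) / ((1 - β) * (ε * T))
      + 6 * σ ^ 2 * (5 - 3 * β) * L ^ 2 * (ε ^ 2 / n) / (1 - β) := by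
    have hA' : N⁻¹ * A ≤ 4 / (1 - β) * ((F w0 - Fstar) / ε
        + 3 * (L ^ 2 * ε ^ 2) * (T * (σ ^ 2 / n))) := by
      rw [inv_mul_le_iff₀ hN0]
      refine le_of_mul_le_mul_left (hbound.trans_eq ?_) (by linarith : 0 < (1 - β) / 4)
      field_simp
    have hcoef : 12 * (L ^ 2 * ε ^ 2) * (σ ^ 2 / n) / (1 - β)
        ≤ 6 * σ ^ 2 * (5 - 3 * β) * L ^ 2 * (ε ^ 2 / n) / (1 - β) := by
      refine div_le_div_of_nonneg_right ?_ hβ'.le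
      have h : 0 ≤ σ ^ 2 * L ^ 2 * (ε ^ 2 / n) * (1 - β) := by positivity
      have h' : L ^ 2 * ε ^ 2 * (σ ^ 2 / n) = σ ^ 2 * L ^ 2 * (ε ^ 2 / n) := by ring
      nlinarith
    refine ((div_le_div_of_nonneg_right hA' hT'.le).trans_eq ?_).trans
      (add_le_add_right hcoef (4 * (F w0 - Fstar) / ((1 - β) * (ε * T))))
    field_simp
    ring
  rw [hlhs]
  refine havg.trans_eq ?_
  obtain ⟨a, ha⟩ : ∃ a, a = (n : ℝ) ^ ((1 : ℝ) / 3) := ⟨_, rfl⟩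
  obtain ⟨b, hb⟩ : ∃ b, b = (T : ℝ) ^ ((1 : ℝ) / 3) := ⟨_, rfl⟩
  have ha0 : 0 < a := by rw [ha]; positivity
  have hb0 : 0 < b := by rw [hb]; positivity
  have ha3 : (n : ℝ) = a ^ 3 := by
    rw [ha, ← Real.rpow_natCast, ← Real.rpow_mul hn'.le]; norm_num
  have hb3 : (T : ℝ) = b ^ 3 := by
    rw [hb, ← Real.rpow_natCast, ← Real.rpow_mul hT'.le]; norm_num
  have hb2 : (T : ℝ) ^ ((2 : ℝ) / 3) = b ^ 2 := by
    rw [hb, ← Real.rpow_natCast, ← Real.rpow_mul hT'.le]; norm_num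
  rw [← ha, ← hb] at hε
  rw [hb2, ← ha, hε, ha3, hb3]
  field_simp
end
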